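/- arXiv:1101.3267 — 2 statements merged into one kernel-verified Lean document; each statement's English description precedes it below -/
import Mathlib

section
/- (Finiteness of Graver complexity.) For every integer (r,s)×t bimatrix A there exists a nonnegative integer g such that for every positive integer n and every element v = (v¹,…,vⁿ) of the Graver basis 𝒢(A⁽ⁿ⁾), the number of indices i with vⁱ ≠ 0 is at most g. -/
open Matrix

/-- The conformal (sign-compatible) partial order `x ⊑ y` on integer vectors:
`x k * y k ≥ 0` and `|x k| ≤ |y k|` for every coordinate `k`. -/
def ConformalLe {ν : Type*} (x y : ν → ℤ) : Prop :=
  ∀ k, 0 ≤ x k * y k ∧ |x k| ≤ |y k|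

/-- The Graver basis of an integer matrix `A`: the set of `⊑`-minimal elements of
`{x : A x = 0, x ≠ 0}`. -/
def GraverBasis {μ ν : Type*} [Fintype ν] (A : Matrix μ ν ℤ) : Set (ν → ℤ) :=
  {x | A.mulVec x = 0 ∧ x ≠ 0 ∧
    ∀ y, A.mulVec y = 0 → y ≠ 0 → ConformalLe y x → y = x}

/-- The `ι`-fold product of the bimatrix with blocks `A1` (first block, `r × τ`) and
`A2` (second block, `s × τ`): the first `r` rows are `(A1 A1 ⋯ A1)` and the remaining
rows form a block-diagonal matrix with a copy of `A2` for each index in `ι`. -/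
def nFold {r s : ℕ} {τ : Type*} (A1 : Matrix (Fin r) τ ℤ) (A2 : Matrix (Fin s) τ ℤ)
    (ι : Type*) [DecidableEq ι] : Matrix (Fin r ⊕ ι × Fin s) (ι × τ) ℤ :=
  Matrix.of fun i jt =>
    match i with
    | Sum.inl a => A1 a jt.2
    | Sum.inr (k, c) => if jt.1 = k then A2 c jt.2 else 0

/-- The `i`-th brick of a vector indexed by `ι × τ`. -/
def brick {ι τ : Type*} (x : ι × τ → ℤ) (i : ι) : τ → ℤ := fun j => x (i, j)

/-- The Graver complexity of the bimatrix `(A1, A2)`: the largest number of nonzero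
bricks appearing in any element of the Graver basis of any `n`-fold product. -/
noncomputable def graverComplexity {r s t : ℕ} (A1 : Matrix (Fin r) (Fin t) ℤ)
    (A2 : Matrix (Fin s) (Fin t) ℤ) : ℕ :=
  sSup {k : ℕ | ∃ (n : ℕ) (g : Fin n × Fin t → ℤ),
    g ∈ GraverBasis (nFold A1 A2 (Fin n)) ∧
    k = {i : Fin n | brick g i ≠ 0}.ncard}

/-- `Z(A)`: the set of all vectors in `ℤ^t` that are sums of at most `g(A)` elements
of the Graver basis of `A2`. -/
noncomputable def ZSet {r s t : ℕ} (A1 : Matrix (Fin r) (Fin t) ℤ)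
    (A2 : Matrix (Fin s) (Fin t) ℤ) : Set (Fin t → ℤ) :=
  {z | ∃ L : List (Fin t → ℤ), L.length ≤ graverComplexity A1 A2 ∧
    (∀ h ∈ L, h ∈ GraverBasis A2) ∧ z = L.sum}

/-- Recording the positive and negative parts of the coordinates turns the conformal order on
integer vectors into a product of copies of the order on `ℕ`. -/
def posNegParts {ν : Type*} (x : ν → ℤ) : ν → ℕ × ℕ := fun k => ((x k).toNat, (-x k).toNat)

theorem conformalLe_of_posNegParts_le {ν : Type*} {x y : ν → ℤ}
    (h : posNegParts x ≤ posNegParts y) : ConformalLe x y := by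
  intro k
  obtain ⟨h₁, h₂⟩ : (x k).toNat ≤ (y k).toNat ∧ (-x k).toNat ≤ (-y k).toNat := h k
  refine ⟨?_, by rw [Int.abs_eq_natAbs, Int.abs_eq_natAbs]; omega⟩
  rcases le_total 0 (x k) with hx | hx
  · rcases hx.eq_or_lt with hx | hx
    · simp [← hx]
    · exact mul_nonneg hx.le (by omega)
  · rcases hx.eq_or_lt with hx | hx
    · simp [hx]
    · exact mul_nonneg_of_nonpos_of_nonpos hx.le (by omega)

theorem nFold_mulVec_eq_zero_iff {r s : ℕ} {τ ι : Type*} [Fintype τ] [Fintype ι] [DecidableEq ι]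
    (A1 : Matrix (Fin r) τ ℤ) (A2 : Matrix (Fin s) τ ℤ) (x : ι × τ → ℤ) :
    (nFold A1 A2 ι).mulVec x = 0 ↔
      A1.mulVec (∑ i, brick x i) = 0 ∧ ∀ i, A2.mulVec (brick x i) = 0 := by
  have hl (a : Fin r) : (nFold A1 A2 ι).mulVec x (Sum.inl a) = A1.mulVec (∑ i, brick x i) a := by
    simp only [Matrix.mulVec, dotProduct, nFold, brick, Fintype.sum_prod_type, Matrix.of_apply,
      Finset.sum_apply, Finset.mul_sum]
    exact Finset.sum_comm
  have hr (i : ι) (c : Fin s) :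
      (nFold A1 A2 ι).mulVec x (Sum.inr (i, c)) = A2.mulVec (brick x i) c := by
    simp only [Matrix.mulVec, dotProduct, nFold, brick, Fintype.sum_prod_type, Matrix.of_apply]
    rw [Finset.sum_eq_single i] <;> simp +contextual
  constructor
  · intro h
    refine ⟨funext fun a => ?_, fun i => funext fun c => ?_⟩
    · rw [← hl, h]; rfl
    · rw [← hr, h]; rfl
  · rintro ⟨h₁, h₂⟩
    funext p
    rcases p with a | ⟨i, c⟩
    · rw [hl, h₁]; rfl
    · rw [hr, h₂]; rfl

/-- If the bricks of a Graver basis element `v` are conformally below distinct bricks of a Graver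
basis element `w`, then `v` and `w` have the same number of nonzero bricks. -/
theorem ncard_brick_ne_zero_eq_of_embedding {r s : ℕ} {τ ι κ : Type*} [Fintype τ]
    [Fintype ι] [DecidableEq ι] [Fintype κ] [DecidableEq κ]
    {A1 : Matrix (Fin r) τ ℤ} {A2 : Matrix (Fin s) τ ℤ} {v : ι × τ → ℤ} {w : κ × τ → ℤ}
    (hv : v ∈ GraverBasis (nFold A1 A2 ι)) (hw : w ∈ GraverBasis (nFold A1 A2 κ))
    (f : ι ↪ κ) (hf : ∀ i, ConformalLe (brick v i) (brick w (f i))) :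
    {i | brick v i ≠ 0}.ncard = {j | brick w j ≠ 0}.ncard := by
  obtain ⟨hv₀, hv_ne, -⟩ := hv
  obtain ⟨-, -, hw_min⟩ := hw
  rw [nFold_mulVec_eq_zero_iff] at hv₀
  let u : κ × τ → ℤ := fun p => Function.extend f (brick v) (0 : κ → τ → ℤ) p.1 p.2
  have hu (i : ι) : brick u (f i) = brick v i := f.injective.extend_apply _ _ i
  have hu' (j : κ) (hj : j ∉ Set.range f) : brick u j = 0 :=
    Function.extend_apply' _ _ j hj
  have hu_eq : u = w := by
    apply hw_min
    · rw [nFold_mulVec_eq_zero_iff]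
      constructor
      · rw [← Fintype.sum_of_injective f f.injective _ _ hu' fun i => (hu i).symm]
        exact hv₀.1
      · intro j
        by_cases hj : j ∈ Set.range f
        · obtain ⟨i, rfl⟩ := hj
          rw [hu, hv₀.2]
        · rw [hu' j hj, Matrix.mulVec_zero]
    · contrapose! hv_ne
      funext ⟨i, c⟩
      have := congrFun (hu i) c
      rw [hv_ne] at this
      exact this.symm
    · rintro ⟨j, c⟩
      by_cases hj : j ∈ Set.range f
      · obtain ⟨i, rfl⟩ := hj
        have h : u (f i, c) = brick v i c := congrFun (hu i) c
        rw [h]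
        exact hf i c
      · have h : u (j, c) = 0 := congrFun (hu' j hj) c
        simp [h]
  rw [← Set.ncard_image_of_injective _ f.injective, ← hu_eq]
  congr 1
  ext j
  constructor
  · rintro ⟨i, hi, rfl⟩
    rwa [Set.mem_ofPred_eq, hu]
  · intro hj
    by_cases h : j ∈ Set.range f
    · obtain ⟨i, rfl⟩ := h
      exact ⟨i, by rwa [Set.mem_ofPred_eq, hu] at hj, rfl⟩
    · exact absurd (hu' j h) hj

/-- **Higman's lemma** for finite sequences: among infinitely many finite sequences in a well
quasi-order, one embeds into a later one. -/
theorem exists_lt_embedding_le {α : Type*} [Preorder α] [WellQuasiOrderedLE α] (n : ℕ → ℕ)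
    (x : ∀ k, Fin (n k) → α) :
    ∃ k l, k < l ∧ ∃ f : Fin (n k) ↪ Fin (n l), ∀ i, x k i ≤ x l (f i) := by
  obtain ⟨k, l, hkl, h⟩ := (Set.isPWO_of_wellQuasiOrderedLE
    (Set.univ : Set α)).partiallyWellOrderedOn_sublistForall₂ (· ≤ ·)
    (fun k => ⟨List.ofFn (x k), by simp⟩)
  obtain ⟨L, hL, hsub⟩ := List.sublistForall₂_iff.1 h
  obtain ⟨f, hf⟩ := List.sublist_iff_exists_fin_orderEmbedding_get_eq.1 hsub
  obtain ⟨hlen, hL⟩ := List.forall₂_iff_get.1 hL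
  have hk : n k = L.length := by simpa using hlen
  refine ⟨k, l, hkl, ((finCongr hk).toEmbedding.trans f.toEmbedding).trans
    (finCongr (by simp)).toEmbedding, fun i => ?_⟩
  have h₁ := hL i (by simp) (hk ▸ i.2)
  have h₂ := hf (finCongr hk i)
  simp only [List.get_eq_getElem, List.getElem_ofFn] at h₁ h₂
  exact h₁.trans_eq h₂

/-- **finiteness of Graver complexity.** For every integer `(r,s) × t`
bimatrix `A` there is a nonnegative integer `g` bounding, for every `n`, the number of
nonzero bricks of every element of the Graver basis of the `n`-fold product. -/
theorem graver_complexity_finite {r s t : ℕ} (A1 : Matrix (Fin r) (Fin t) ℤ)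
    (A2 : Matrix (Fin s) (Fin t) ℤ) :
    ∃ g : ℕ, ∀ (n : ℕ), 0 < n → ∀ v ∈ GraverBasis (nFold A1 A2 (Fin n)),
      {i : Fin n | brick v i ≠ 0}.ncard ≤ g := by
  let S : Set ℕ := {k | ∃ (n : ℕ) (v : Fin n × Fin t → ℤ),
    v ∈ GraverBasis (nFold A1 A2 (Fin n)) ∧ {i | brick v i ≠ 0}.ncard = k}
  suffices hS : BddAbove S by
    obtain ⟨g, hg⟩ := hS
    exact ⟨g, fun n _ v hv => hg ⟨n, v, hv, rfl⟩⟩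
  by_contra hS
  have : Infinite S := (Set.infinite_of_not_bddAbove hS).to_subtype
  choose n v hv hcard using fun k => (Nat.Subtype.orderIsoOfNat S k).2
  obtain ⟨k, l, hkl, f, hf⟩ := exists_lt_embedding_le n fun k i => posNegParts (brick (v k) i)
  have h := ncard_brick_ne_zero_eq_of_embedding (hv k) (hv l) f
    fun i => conformalLe_of_posNegParts_le (hf i)
  rw [hcard, hcard] at h
  exact hkl.ne ((Nat.Subtype.orderIsoOfNat S).injective (Subtype.ext h))
end

section
/- (Separable convex optimality certification via Z(A).) Let A be an integer (r,s)×t bimatrix, let f : ℝ^{nt} → ℝ be separable convex, and let x be a feasible point of the n-fold system A⁽ⁿ⁾x = b, l ≤ x ≤ u with finite bounds. Then x minimizes f over the feasible points if and only if there is no g = (g¹,…,gⁿ) ∈ ℤ^{nt} with every brick gⁱ in Z(A), A⁽ⁿ⁾g = 0, l ≤ x + g ≤ u, and f(x+g) < f(x). -/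
open Matrix

theorem conformalLe_iff {ν : Type*} {x y : ν → ℤ} :
    ConformalLe x y ↔ ∀ k, (0 ≤ x k ∧ x k ≤ y k) ∨ (y k ≤ x k ∧ x k ≤ 0) := by
  refine forall_congr' fun k => ⟨fun ⟨h, h'⟩ => ?_, fun h => ?_⟩
  · rcases mul_nonneg_iff.1 h with ⟨hx, hy⟩ | ⟨hx, hy⟩
    · rw [abs_of_nonneg hx, abs_of_nonneg hy] at h'
      exact Or.inl ⟨hx, h'⟩
    · rw [abs_of_nonpos hx, abs_of_nonpos hy] at h'
      exact Or.inr ⟨by linarith, hx⟩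
  · rcases h with ⟨hx, hy⟩ | ⟨hy, hx⟩
    · exact ⟨mul_nonneg hx (hx.trans hy), abs_le_abs_of_nonneg hx hy⟩
    · exact ⟨mul_nonneg_of_nonpos_of_nonpos hx (hy.trans hx), abs_le_abs_of_nonpos hx hy⟩

theorem ConformalLe.refl {ν : Type*} (x : ν → ℤ) : ConformalLe x x :=
  fun _ => ⟨mul_self_nonneg _, le_rfl⟩

theorem ConformalLe.zero {ν : Type*} (x : ν → ℤ) : ConformalLe 0 x :=
  fun _ => by simp

theorem ConformalLe.trans {ν : Type*} {x y z : ν → ℤ} (hxy : ConformalLe x y)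
    (hyz : ConformalLe y z) : ConformalLe x z := by
  rw [conformalLe_iff] at *
  intro k
  have := hxy k
  have := hyz k
  omega

theorem ConformalLe.sub {ν : Type*} {x y : ν → ℤ} (h : ConformalLe x y) :
    ConformalLe (y - x) y := by
  rw [conformalLe_iff] at *
  intro k
  have := h k
  simp only [Pi.sub_apply]
  omega

instance {ν : Type*} : IsPreorder (ν → ℤ) ConformalLe where
  refl := ConformalLe.refl
  trans _ _ _ := ConformalLe.trans

/-- The conformal order on integer vectors is a well-quasi-order (Gordan's lemma). -/
theorem wellQuasiOrdered_conformalLe {ν : Type*} [Finite ν] :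
    WellQuasiOrdered (ConformalLe : (ν → ℤ) → (ν → ℤ) → Prop) := by
  intro x
  obtain ⟨m, n, hmn, h⟩ := wellQuasiOrdered_le
    (fun i => (fun k => ((x i k).toNat, (-x i k).toNat) : ν → ℕ × ℕ))
  refine ⟨m, n, hmn, conformalLe_iff.2 fun k => ?_⟩
  have h1 := (h k).1
  have h2 := (h k).2
  simp only at h1 h2
  omega

theorem ConformalLe.sum_natAbs_lt {ν : Type*} [Fintype ν] {x y : ν → ℤ} (h : ConformalLe x y)
    (hne : x ≠ y) : ∑ k, (x k).natAbs < ∑ k, (y k).natAbs := by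
  obtain ⟨k, hk⟩ := Function.ne_iff.1 hne
  rw [conformalLe_iff] at h
  refine Finset.sum_lt_sum (fun i _ => ?_) ⟨k, Finset.mem_univ _, ?_⟩
  · have := h i
    omega
  · have := h k
    omega

theorem ConformalLe.sum {ν κ : Type*} [Fintype κ] {y h : κ → ν → ℤ}
    (hh : ∀ m, ConformalLe (h m) (∑ m, h m)) (hy : ∀ m, ConformalLe (y m) (h m)) :
    ConformalLe (∑ m, y m) (∑ m, h m) := by
  simp only [conformalLe_iff, Finset.sum_apply] at *
  intro k
  rcases le_total 0 (∑ m, h m k) with h0 | h0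
  · refine Or.inl ⟨Finset.sum_nonneg fun m _ => ?_, Finset.sum_le_sum fun m _ => ?_⟩ <;>
    · have := hh m k
      have := hy m k
      omega
  · refine Or.inr ⟨Finset.sum_le_sum fun m _ => ?_, Finset.sum_nonpos fun m _ => ?_⟩ <;>
    · have := hh m k
      have := hy m k
      omega

theorem ConformalLe.eq_zero_of_sum_eq_zero {ν κ : Type*} [Fintype κ] {y h : κ → ν → ℤ}
    (hh : ∀ m, ConformalLe (h m) (∑ m, h m)) (hy : ∀ m, ConformalLe (y m) (h m))
    (h0 : ∑ m, y m = 0) : y = 0 := by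
  ext m k
  replace h0 := congrFun h0 k
  simp only [conformalLe_iff, Finset.sum_apply, Pi.zero_apply] at *
  rcases le_total 0 (∑ m, h m k) with h1 | h1
  · refine (Finset.sum_eq_zero_iff_of_nonneg fun m _ => ?_).1 h0 m (Finset.mem_univ _)
    have := hh m k
    have := hy m k
    omega
  · refine (Finset.sum_eq_zero_iff_of_nonpos fun m _ => ?_).1 h0 m (Finset.mem_univ _)
    have := hh m k
    have := hy m k
    omega

theorem ConformalLe.eq_of_sum_eq {ν κ : Type*} [Fintype κ] {y h : κ → ν → ℤ}
    (hh : ∀ m, ConformalLe (h m) (∑ m, h m)) (hy : ∀ m, ConformalLe (y m) (h m))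
    (heq : ∑ m, y m = ∑ m, h m) : y = h := by
  refine (sub_eq_zero.1 (eq_zero_of_sum_eq_zero (y := h - y) hh (fun m => (hy m).sub) ?_)).symm
  simp [Finset.sum_sub_distrib, heq]

theorem exists_mem_graverBasis_conformalLe {μ ν : Type*} [Fintype ν] (A : Matrix μ ν ℤ)
    {x : ν → ℤ} (hx : A.mulVec x = 0) (hx0 : x ≠ 0) :
    ∃ g ∈ GraverBasis A, ConformalLe g x := by
  induction hN : ∑ k, (x k).natAbs using Nat.strong_induction_on generalizing x with
  | _ N ih =>
    by_cases hmin : x ∈ GraverBasis A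
    · exact ⟨x, hmin, ConformalLe.refl x⟩
    · simp only [GraverBasis, Set.mem_ofPred_eq, not_and, not_forall] at hmin
      obtain ⟨y, hy, hy0, hyx, hne⟩ := hmin hx hx0
      obtain ⟨g, hg, hgy⟩ := ih _ (hN ▸ hyx.sum_natAbs_lt hne) hy hy0 rfl
      exact ⟨g, hg, hgy.trans hyx⟩

/-- Every kernel vector is a sum of Graver basis elements conformal to it. -/
theorem exists_list_graverBasis_sum {μ ν : Type*} [Fintype ν] (A : Matrix μ ν ℤ)
    {x : ν → ℤ} (hx : A.mulVec x = 0) :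
    ∃ L : List (ν → ℤ), (∀ g ∈ L, g ∈ GraverBasis A ∧ ConformalLe g x) ∧ L.sum = x := by
  induction hN : ∑ k, (x k).natAbs using Nat.strong_induction_on generalizing x with
  | _ N ih =>
    by_cases hx0 : x = 0
    · exact ⟨[], by simp, by simp [hx0]⟩
    · obtain ⟨g, hg, hgx⟩ := exists_mem_graverBasis_conformalLe A hx hx0
      have hne : x - g ≠ x := fun h => hg.2.1 (by simpa using h)
      obtain ⟨L, hL, hsum⟩ := ih _ (hN ▸ hgx.sub.sum_natAbs_lt hne)
        (by rw [Matrix.mulVec_sub, hx, hg.1, sub_zero]) rfl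
      refine ⟨g :: L, ?_, by simp [hsum]⟩
      simp only [List.mem_cons, forall_eq_or_imp]
      exact ⟨⟨hg, hgx⟩, fun h hh => ⟨(hL h hh).1, (hL h hh).2.trans hgx.sub⟩⟩

theorem exists_fin_graverBasis_sum {μ ν : Type*} [Fintype ν] (A : Matrix μ ν ℤ)
    {x : ν → ℤ} (hx : A.mulVec x = 0) :
    ∃ (m : ℕ) (h : Fin m → ν → ℤ), (∀ i, h i ∈ GraverBasis A) ∧ (∀ i, ConformalLe (h i) x) ∧
      ∑ i, h i = x := by
  obtain ⟨L, hL, hsum⟩ := exists_list_graverBasis_sum A hx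
  refine ⟨L.length, L.get, fun i => (hL _ (L.get_mem i)).1, fun i => (hL _ (L.get_mem i)).2, ?_⟩
  rw [← hsum, ← List.sum_ofFn, List.ofFn_get]

section NFold

variable {r s : ℕ} {τ ι κ : Type*} [Fintype τ] [Fintype ι] [Fintype κ] [DecidableEq κ]
  {A1 : Matrix (Fin r) τ ℤ} {A2 : Matrix (Fin s) τ ℤ}

theorem nFold_mulVec_uncurry_eq_zero_iff [DecidableEq ι] {y : ι → τ → ℤ} :
    (nFold A1 A2 ι).mulVec (Function.uncurry y) = 0 ↔
      A1.mulVec (∑ i, y i) = 0 ∧ ∀ i, A2.mulVec (y i) = 0 := by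
  have h1 (a : Fin r) : (nFold A1 A2 ι).mulVec (Function.uncurry y) (Sum.inl a) =
      A1.mulVec (∑ i, y i) a := by
    simp only [nFold, Matrix.mulVec, dotProduct, Fintype.sum_prod_type, Matrix.of_apply,
      Function.uncurry_apply_pair, Finset.sum_apply, Finset.mul_sum]
    exact Finset.sum_comm
  have h2 (i : ι) (c : Fin s) : (nFold A1 A2 ι).mulVec (Function.uncurry y) (Sum.inr (i, c)) =
      A2.mulVec (y i) c := by
    simp [nFold, Matrix.mulVec, dotProduct, Fintype.sum_prod_type, Finset.sum_comm (γ := ι)]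
  simp only [funext_iff, Sum.forall, Prod.forall, h1, h2, Pi.zero_apply]

theorem uncurry_mem_graverBasis_nFold_iff [DecidableEq ι] {y : ι → τ → ℤ} :
    Function.uncurry y ∈ GraverBasis (nFold A1 A2 ι) ↔
      (A1.mulVec (∑ i, y i) = 0 ∧ ∀ i, A2.mulVec (y i) = 0) ∧ y ≠ 0 ∧
        ∀ z : ι → τ → ℤ, A1.mulVec (∑ i, z i) = 0 → (∀ i, A2.mulVec (z i) = 0) → z ≠ 0 →
          (∀ i, ConformalLe (z i) (y i)) → z = y := by
  have h0 (z : ι → τ → ℤ) : Function.uncurry z = 0 ↔ z = 0 := by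
    simp [funext_iff]
  simp only [GraverBasis, Set.mem_ofPred_eq, nFold_mulVec_uncurry_eq_zero_iff, ne_eq, h0]
  refine and_congr_right fun _ => and_congr_right fun _ => ⟨fun h z hz1 hz2 hz0 hzy => ?_,
    fun h z hz hz0 hzy => ?_⟩
  · have := h (Function.uncurry z) (nFold_mulVec_uncurry_eq_zero_iff.2 ⟨hz1, hz2⟩)
      (mt (h0 z).1 hz0) fun p => hzy p.1 p.2
    exact Function.uncurry_injective this
  · obtain ⟨z, rfl⟩ : ∃ w, z = Function.uncurry w := ⟨Function.curry z, by simp⟩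
    rw [nFold_mulVec_uncurry_eq_zero_iff] at hz
    rw [h z hz.1 hz.2 (mt (h0 z).2 hz0) fun i j => hzy (i, j)]

/-- A Graver basis element of an `n`-fold product dominates conformally only itself among the
nonzero kernel vectors of smaller products, extended by zero along an injection. -/
theorem extend_eq_of_mem_graverBasis_nFold {y : κ → τ → ℤ}
    (hy : Function.uncurry y ∈ GraverBasis (nFold A1 A2 κ)) {φ : ι → κ}
    (hφ : Function.Injective φ) {z : ι → τ → ℤ} (hz1 : A1.mulVec (∑ i, z i) = 0)
    (hz2 : ∀ i, A2.mulVec (z i) = 0) (hz0 : z ≠ 0) (hzy : ∀ i, ConformalLe (z i) (y (φ i))) :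
    Function.extend φ z 0 = y := by
  have hsum : ∑ i, z i = ∑ j, Function.extend φ z 0 j :=
    Fintype.sum_of_injective φ hφ _ _ (fun j hj => Function.extend_apply' _ _ _ hj)
      fun i => (hφ.extend_apply _ _ _).symm
  refine (uncurry_mem_graverBasis_nFold_iff.1 hy).2.2 _ (hsum ▸ hz1) (fun j => ?_) (fun h => ?_)
    fun j => ?_
  · by_cases hj : ∃ i, φ i = j
    · obtain ⟨i, rfl⟩ := hj
      rw [hφ.extend_apply, hz2]
    · rw [Function.extend_apply' _ _ _ hj, Pi.zero_apply, Matrix.mulVec_zero]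
  · refine hz0 (funext fun i => ?_)
    rw [← hφ.extend_apply z 0 i, h, Pi.zero_apply, Pi.zero_apply]
  · by_cases hj : ∃ i, φ i = j
    · obtain ⟨i, rfl⟩ := hj
      rw [hφ.extend_apply]
      exact hzy i
    · rw [Function.extend_apply' _ _ _ hj]
      exact ConformalLe.zero _

theorem uncurry_comp_mem_graverBasis_nFold [DecidableEq ι] {y : κ → τ → ℤ}
    (hy : Function.uncurry y ∈ GraverBasis (nFold A1 A2 κ)) {φ : ι → κ}
    (hφ : Function.Injective φ) (h0 : ∀ j ∉ Set.range φ, y j = 0) :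
    Function.uncurry (y ∘ φ) ∈ GraverBasis (nFold A1 A2 ι) := by
  have hy' := uncurry_mem_graverBasis_nFold_iff.1 hy
  have hsum : ∑ i, (y ∘ φ) i = ∑ j, y j :=
    Fintype.sum_of_injective φ hφ _ _ h0 fun _ => rfl
  refine uncurry_mem_graverBasis_nFold_iff.2 ⟨⟨hsum ▸ hy'.1.1, fun i => hy'.1.2 _⟩, fun h => ?_,
    fun z hz1 hz2 hz0 hzy => funext fun i => ?_⟩
  · refine hy'.2.1 (funext fun j => ?_)
    by_cases hj : j ∈ Set.range φ
    · obtain ⟨i, rfl⟩ := hj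
      exact congrFun h i
    · exact h0 j hj
  · rw [← hφ.extend_apply z 0 i, extend_eq_of_mem_graverBasis_nFold hy hφ hz1 hz2 hz0 hzy,
      Function.comp_apply]

/-- Splitting the bricks of a Graver basis element of an `n`-fold product conformally into kernel
vectors yields a Graver basis element of a larger product. -/
theorem uncurry_sigma_mem_graverBasis_nFold [DecidableEq ι] {m : ι → ℕ}
    {h : (i : ι) → Fin (m i) → τ → ℤ}
    (hg : Function.uncurry (fun i => ∑ a, h i a) ∈ GraverBasis (nFold A1 A2 ι))
    (hker : ∀ i a, A2.mulVec (h i a) = 0) (hconf : ∀ i a, ConformalLe (h i a) (∑ a, h i a)) :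
    Function.uncurry (fun p : (i : ι) × Fin (m i) => h p.1 p.2) ∈
      GraverBasis (nFold A1 A2 ((i : ι) × Fin (m i))) := by
  have hg' := uncurry_mem_graverBasis_nFold_iff.1 hg
  refine uncurry_mem_graverBasis_nFold_iff.2 ⟨⟨?_, fun p => hker _ _⟩, fun h0 => ?_,
    fun z hz1 hz2 hz0 hzh => ?_⟩
  · rw [Fintype.sum_sigma]
    exact hg'.1.1
  · exact hg'.2.1 (funext fun i => Finset.sum_eq_zero fun a _ => congrFun h0 ⟨i, a⟩)
  · have key := hg'.2.2 (fun i => ∑ a, z ⟨i, a⟩) (by rwa [Fintype.sum_sigma] at hz1)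
      (fun i => by rw [Matrix.mulVec_sum]; exact Finset.sum_eq_zero fun a _ => hz2 _)
      (fun h0 => hz0 (funext fun ⟨i, a⟩ => congrFun
        (ConformalLe.eq_zero_of_sum_eq_zero (hconf i) (fun a => hzh ⟨i, a⟩) (congrFun h0 i)) a))
      (fun i => ConformalLe.sum (hconf i) fun a => hzh ⟨i, a⟩)
    exact funext fun ⟨i, a⟩ => congrFun
      (ConformalLe.eq_of_sum_eq (hconf i) (fun a => hzh ⟨i, a⟩) (congrFun key i)) a

/-- By Higman's lemma, only finitely many lists of nonzero bricks form Graver basis elements of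
`n`-fold products of a given bimatrix. -/
theorem finite_setOf_list_mem_graverBasis_nFold (A1 : Matrix (Fin r) τ ℤ)
    (A2 : Matrix (Fin s) τ ℤ) :
    {L : List (τ → ℤ) | (∀ v ∈ L, v ≠ 0) ∧
      Function.uncurry L.get ∈ GraverBasis (nFold A1 A2 (Fin L.length))}.Finite := by
  have hwqo : {L : List (τ → ℤ) | ∀ v ∈ L, v ∈ Set.univ}.PartiallyWellOrderedOn
      (List.SublistForall₂ ConformalLe) :=
    Set.PartiallyWellOrderedOn.partiallyWellOrderedOn_sublistForall₂ _
      (Set.partiallyWellOrderedOn_univ_iff.2 wellQuasiOrdered_conformalLe)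
  refine IsAntichain.finite_of_partiallyWellOrderedOn ?_ (hwqo.mono fun _ _ _ _ => Set.mem_univ _)
  rintro L ⟨-, hL⟩ L' ⟨hL'0, hL'⟩ hne hsub
  refine hne ?_
  obtain ⟨M, hLM, hM⟩ := List.sublistForall₂_iff.1 hsub
  obtain ⟨f, hf⟩ := List.sublist_iff_exists_fin_orderEmbedding_get_eq.1 hM
  obtain ⟨hlen, hconf⟩ := List.forall₂_iff_get.1 hLM
  let φ : Fin L.length → Fin L'.length := fun i => f (i.cast hlen)
  have hφ : Function.Injective φ := f.injective.comp (Fin.cast_injective hlen)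
  have hker := uncurry_mem_graverBasis_nFold_iff.1 hL
  have hext := extend_eq_of_mem_graverBasis_nFold hL' hφ hker.1.1 hker.1.2 hker.2.1
    fun i => (hf (i.cast hlen)) ▸ hconf i.1 i.2 (hlen ▸ i.2)
  have hsurj : Function.Surjective φ := fun j => by
    by_contra hj
    refine hL'0 _ (L'.get_mem j) ?_
    rw [← hext, Function.extend_apply' _ _ _ hj, Pi.zero_apply]
  have hcard : L.length = L'.length := by
    simpa using Fintype.card_of_bijective ⟨hφ, hsurj⟩
  have hML' : M = L' := hM.eq_of_length (hlen ▸ hcard)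
  rw [← hML']
  refine List.ext_get hlen fun i h1 h2 => ?_
  rw [hf ⟨i, h2⟩, ← hext]
  exact (hφ.extend_apply L.get 0 ⟨i, h1⟩).symm

end NFold

theorem bddAbove_setOf_ncard_brick_ne_zero {r s t : ℕ} (A1 : Matrix (Fin r) (Fin t) ℤ)
    (A2 : Matrix (Fin s) (Fin t) ℤ) :
    BddAbove {k : ℕ | ∃ (n : ℕ) (g : Fin n × Fin t → ℤ),
      g ∈ GraverBasis (nFold A1 A2 (Fin n)) ∧ k = {i : Fin n | brick g i ≠ 0}.ncard} := by
  refine ((finite_setOf_list_mem_graverBasis_nFold A1 A2).image List.length).bddAbove.mono ?_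
  rintro k ⟨n, g, hg, hk⟩
  have hcard : Nat.card {i : Fin n | brick g i ≠ 0} = k := hk.symm
  let e := (Finite.equivFinOfCardEq hcard).symm
  have hlen : (List.ofFn fun i => brick g (e i)).length = k := List.length_ofFn
  refine ⟨List.ofFn fun i => brick g (e i), ⟨fun v hv => ?_, ?_⟩, hlen⟩
  · obtain ⟨i, rfl⟩ := (List.mem_ofFn' _ _).1 hv
    exact (e i).2
  · have hcomp : (List.ofFn fun i => brick g (e i)).get =
        brick g ∘ fun i => (e (i.cast hlen) : Fin n) := by
      ext i
      simp
      rfl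
    rw [hcomp]
    refine uncurry_comp_mem_graverBasis_nFold (y := brick g) hg
      (Subtype.val_injective.comp (e.injective.comp (Fin.cast_injective hlen))) fun j hj => ?_
    by_contra hj0
    exact hj ⟨(e.symm ⟨j, hj0⟩).cast hlen.symm, by simp⟩

/-- The bricks of a Graver basis element of an `n`-fold product lie in `Z(A)`. -/
theorem brick_mem_ZSet_of_mem_graverBasis {r s t n : ℕ} {A1 : Matrix (Fin r) (Fin t) ℤ}
    {A2 : Matrix (Fin s) (Fin t) ℤ} {g : Fin n × Fin t → ℤ}
    (hg : g ∈ GraverBasis (nFold A1 A2 (Fin n))) (i : Fin n) : brick g i ∈ ZSet A1 A2 := by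
  have hker := (uncurry_mem_graverBasis_nFold_iff (y := brick g)).1 hg
  choose m h hmem hconf hsum using fun i => exists_fin_graverBasis_sum A2 (hker.1.2 i)
  have hsplit := uncurry_sigma_mem_graverBasis_nFold (A1 := A1) (A2 := A2) (m := m) (h := h)
    (by simp only [hsum]; exact hg) (fun i a => (hmem i a).1) (fun i a => (hsum i).symm ▸ hconf i a)
  let e := (Fintype.equivFin ((i : Fin n) × Fin (m i))).symm
  have hfin := uncurry_comp_mem_graverBasis_nFold hsplit e.injective
    fun j hj => (hj (e.surjective j)).elim
  have hle : Fintype.card ((i : Fin n) × Fin (m i)) ≤ graverComplexity A1 A2 := by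
    refine le_csSup (bddAbove_setOf_ncard_brick_ne_zero A1 A2) ⟨_, _, hfin, ?_⟩
    have huniv : {j | brick (Function.uncurry
        ((fun p : (i : Fin n) × Fin (m i) => h p.1 p.2) ∘ e)) j ≠ 0} = Set.univ :=
      Set.eq_univ_of_forall fun j => (hmem (e j).1 (e j).2).2.1
    rw [huniv, Set.ncard_univ, Nat.card_fin]
  refine ⟨List.ofFn (h i), ?_, fun v hv => ?_, by rw [List.sum_ofFn, hsum]⟩
  · rw [List.length_ofFn]
    refine le_trans ?_ hle
    rw [Fintype.card_sigma]
    simpa using Finset.single_le_sum (f := m) (fun _ _ => Nat.zero_le _) (Finset.mem_univ i)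
  · obtain ⟨a, rfl⟩ := (List.mem_ofFn' _ _).1 hv
    exact hmem i a

theorem ConvexOn.sum_sub_le_of_conformal {κ : Type*} [Fintype κ] {F : ℝ → ℝ}
    (hF : ConvexOn ℝ Set.univ F) (a X : ℤ) (b : κ → ℤ) (hX : ∑ i, b i = X)
    (hb : ∀ i, (0 ≤ b i ∧ b i ≤ X) ∨ (X ≤ b i ∧ b i ≤ 0)) :
    ∑ i, (F ((a : ℝ) + b i) - F a) ≤ F ((a : ℝ) + X) - F a := by
  by_cases h0 : X = 0
  · have hb0 (i) : b i = 0 := by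
      have := hb i
      omega
    simp [hb0, h0]
  have h0' : (X : ℝ) ≠ 0 := by exact_mod_cast h0
  have hstep (i) : F ((a : ℝ) + b i) - F a ≤ (b i / X : ℝ) * (F ((a : ℝ) + X) - F a) := by
    have hb' : (0 ≤ (b i : ℝ) ∧ (b i : ℝ) ≤ X) ∨ ((X : ℝ) ≤ b i ∧ (b i : ℝ) ≤ 0) := by
      exact_mod_cast hb i
    have hθ0 : 0 ≤ (b i / X : ℝ) := by
      rcases hb' with ⟨h1, h2⟩ | ⟨h1, h2⟩
      · exact div_nonneg h1 (h1.trans h2)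
      · exact div_nonneg_of_nonpos h2 (h1.trans h2)
    have hθ1 : (b i / X : ℝ) ≤ 1 := by
      rcases hb' with ⟨h1, h2⟩ | ⟨h1, h2⟩
      · exact div_le_one_of_le₀ h2 (h1.trans h2)
      · exact div_le_one_of_ge h1 (h1.trans h2)
    have := hF.2 (Set.mem_univ (a : ℝ)) (Set.mem_univ ((a : ℝ) + X)) (sub_nonneg.2 hθ1) hθ0
      (sub_add_cancel _ _)
    have hpt : (1 - b i / X : ℝ) • (a : ℝ) + (b i / X : ℝ) • ((a : ℝ) + X) = a + b i := by
      simp only [smul_eq_mul]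
      field_simp
      ring
    rw [hpt, smul_eq_mul, smul_eq_mul] at this
    linarith
  calc ∑ i, (F ((a : ℝ) + b i) - F a)
      ≤ ∑ i, (b i / X : ℝ) * (F ((a : ℝ) + X) - F a) := Finset.sum_le_sum fun i _ => hstep i
    _ = F ((a : ℝ) + X) - F a := by
      rw [← Finset.sum_mul, ← Finset.sum_div, ← Int.cast_sum, hX, div_self h0', one_mul]

/-- **separable convex optimality certification via `Z(A)`.** Let
`f(x) = ∑ₖ fₖ(xₖ)` with each univariate `fₖ` convex. A feasible point `x` of the
`n`-fold system minimizes `f` over the feasible points if and only if there is no `g`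
with all bricks in `Z(A)`, `A⁽ⁿ⁾g = 0`, `l ≤ x + g ≤ u`, and `f(x+g) < f(x)`. -/
theorem separable_convex_certification_via_ZSet {r s t n : ℕ}
    (A1 : Matrix (Fin r) (Fin t) ℤ) (A2 : Matrix (Fin s) (Fin t) ℤ)
    (l u : Fin n × Fin t → ℤ) (b : Fin r ⊕ Fin n × Fin s → ℤ)
    (f : (Fin n × Fin t → ℝ) → ℝ) (fk : Fin n × Fin t → ℝ → ℝ)
    (hconv : ∀ k, ConvexOn ℝ Set.univ (fk k))
    (hf : ∀ y, f y = ∑ k, fk k (y k))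
    (x : Fin n × Fin t → ℤ)
    (hxb : (nFold A1 A2 (Fin n)).mulVec x = b) (hxl : l ≤ x) (hxu : x ≤ u) :
    (∀ y : Fin n × Fin t → ℤ, (nFold A1 A2 (Fin n)).mulVec y = b →
        l ≤ y → y ≤ u →
        f (fun k => (x k : ℝ)) ≤ f (fun k => (y k : ℝ))) ↔
      ¬∃ g : Fin n × Fin t → ℤ, (∀ i, brick g i ∈ ZSet A1 A2) ∧
        (nFold A1 A2 (Fin n)).mulVec g = 0 ∧
        l ≤ x + g ∧ x + g ≤ u ∧
        f (fun k => ((x + g) k : ℝ)) < f (fun k => (x k : ℝ)) := by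
  constructor
  · rintro hmin ⟨g, -, hg, hl, hu, hlt⟩
    exact (hmin (x + g) (by rw [Matrix.mulVec_add, hg, add_zero, hxb]) hl hu).not_gt hlt
  · intro hno y hyb hyl hyu
    by_contra! hlt
    obtain ⟨m, h, hmem, hconf, hsum⟩ := exists_fin_graverBasis_sum (nFold A1 A2 (Fin n))
      (x := y - x) (by rw [Matrix.mulVec_sub, hyb, hxb, sub_self])
    have hle (i) : f (fun k => (x k : ℝ)) ≤ f (fun k => ((x + h i) k : ℝ)) := by
      by_contra! hi
      refine hno ⟨h i, fun j => brick_mem_ZSet_of_mem_graverBasis (hmem i) j, (hmem i).1,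
        fun k => ?_, fun k => ?_, by exact_mod_cast hi⟩ <;>
      · have h1 := conformalLe_iff.1 (hconf i) k
        have h2 := hxl k
        have h3 := hxu k
        have h4 := hyl k
        have h5 := hyu k
        simp only [Pi.sub_apply, Pi.add_apply] at *
        omega
    have hsuper : ∑ i, (f (fun k => ((x + h i) k : ℝ)) - f (fun k => (x k : ℝ))) ≤
        f (fun k => (y k : ℝ)) - f (fun k => (x k : ℝ)) := by
      simp only [hf, ← Finset.sum_sub_distrib]
      rw [Finset.sum_comm]
      refine Finset.sum_le_sum fun k _ => ?_
      have := (hconv k).sum_sub_le_of_conformal (x k) (y k - x k) (fun i => h i k)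
        (by rw [← Finset.sum_apply, hsum, Pi.sub_apply])
        (fun i => conformalLe_iff.1 (hconf i) k)
      simpa using this
    have hnonneg : 0 ≤ ∑ i, (f (fun k => ((x + h i) k : ℝ)) - f (fun k => (x k : ℝ))) :=
      Finset.sum_nonneg fun i _ => sub_nonneg.2 (hle i)
    linarith
end
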